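/- Let u : ℝ³ → ℂ be six times continuously differentiable, let k : ℝ → ℂ be four times continuously differentiable, and define f = ∂²u/∂x² + ∂²u/∂y² + ∂²u/∂z² + k(z)²·u. Fix a point (x,y,z) ∈ ℝ³ and fixed positive ratios r_x, r_y, r_z, and set h_x = r_x·h, h_y = r_y·h, h_z = r_z·h. Let w denote the function w(x,y,z) = k(z)²·u(x,y,z). Then, as h → 0⁺, the fourth-order compact scheme residual (δ_x² + δ_y² + δ_z²)u + ((h_x²+h_y²)/12)·δ_x²δ_y²u + ((h_x²+h_z²)/12)·δ_x²δ_z²u + ((h_y²+h_z²)/12)·δ_y²δ_z²u + (1 + (h_x²/12)δ_x² + (h_y²/12)δ_y² + (h_z²/12)δ_z²)w − (1 + (h_x²/12)δ_x² + (h_y²/12)δ_y² + (h_z²/12)δ_z²)f, evaluated at (x,y,z), is O(h⁴). -/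

import Mathlib

/-- Central second difference in the first variable with step `hx`. -/
noncomputable def deltaX2 (hx : ℝ) (v : ℝ → ℝ → ℝ → ℂ) : ℝ → ℝ → ℝ → ℂ :=
  fun x y z => (v (x - hx) y z - 2 * v x y z + v (x + hx) y z) / ((hx : ℂ)) ^ 2

/-- Central second difference in the second variable with step `hy`. -/
noncomputable def deltaY2 (hy : ℝ) (v : ℝ → ℝ → ℝ → ℂ) : ℝ → ℝ → ℝ → ℂ :=
  fun x y z => (v x (y - hy) z - 2 * v x y z + v x (y + hy) z) / ((hy : ℂ)) ^ 2

/-- Central second difference in the third variable with step `hz`. -/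
noncomputable def deltaZ2 (hz : ℝ) (v : ℝ → ℝ → ℝ → ℂ) : ℝ → ℝ → ℝ → ℂ :=
  fun x y z => (v x y (z - hz) - 2 * v x y z + v x y (z + hz)) / ((hz : ℂ)) ^ 2

section CentralDifference

variable {E : Type*} [NormedAddCommGroup E] [NormedSpace ℝ E]

/-- Unnormalised central second difference of `v` at `p` with vector step `a`. -/
noncomputable def centralDiff (a : E) (v : E → ℂ) (p : E) : ℂ :=
  v (p - a) - 2 * v p + v (p + a)

/-- Derivative of `v` in the direction `e`. -/
noncomputable def dirDeriv (e : E) (v : E → ℂ) (p : E) : ℂ :=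
  fderiv ℝ v p e

lemma ContDiff.dirDeriv {v : E → ℂ} {m n : WithTop ℕ∞} (hv : ContDiff ℝ n v) (hmn : m + 1 ≤ n)
    (e : E) : ContDiff ℝ m (dirDeriv e v) :=
  (hv.fderiv_right hmn).clm_apply contDiff_const

lemma ContDiff.dirDeriv_dirDeriv {v : E → ℂ} {m n : WithTop ℕ∞} (hv : ContDiff ℝ n v)
    (hmn : m + 1 + 1 ≤ n) (e : E) : ContDiff ℝ m (_root_.dirDeriv e (_root_.dirDeriv e v)) :=
  (hv.dirDeriv hmn e).dirDeriv le_rfl e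

lemma dirDeriv_comm {v : E → ℂ} (hv : ContDiff ℝ 2 v) (a b : E) :
    dirDeriv a (dirDeriv b v) = dirDeriv b (dirDeriv a v) := by
  funext p
  have hd : DifferentiableAt ℝ (fderiv ℝ v) p :=
    ((hv.fderiv_right (m := 1) (by norm_num)).differentiable (by norm_num)) p
  have key : ∀ a b : E, dirDeriv a (dirDeriv b v) p = fderiv ℝ (fderiv ℝ v) p a b := by
    intro a b
    change fderiv ℝ (fun q => fderiv ℝ v q b) p a = _
    rw [fderiv_clm_apply hd (differentiableAt_const b)]
    simp
  rw [key, key]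
  exact (hv.contDiffAt.isSymmSndFDerivAt (by simp)).eq a b

lemma dirDeriv_sq_comm {v : E → ℂ} (hv : ContDiff ℝ 4 v) (a b : E) :
    dirDeriv a (dirDeriv a (dirDeriv b (dirDeriv b v))) =
      dirDeriv b (dirDeriv b (dirDeriv a (dirDeriv a v))) := by
  have h3 : ∀ e, ContDiff ℝ 3 (dirDeriv e v) := fun e => hv.dirDeriv (by norm_num) e
  have h2 : ∀ e e', ContDiff ℝ 2 (dirDeriv e (dirDeriv e' v)) :=
    fun e e' => (h3 e').dirDeriv (by norm_num) e
  rw [dirDeriv_comm ((h3 b).of_le (by norm_num)) a b, dirDeriv_comm (h2 a b) a b,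
    dirDeriv_comm (hv.of_le (by norm_num)) a b,
    dirDeriv_comm ((h3 a).of_le (by norm_num)) a b]

lemma dirDeriv_smul_sq {v : E → ℂ} (hv : ContDiff ℝ 2 v) (r : ℝ) (e p : E) :
    dirDeriv (r • e) (dirDeriv (r • e) v) p = (r : ℂ) ^ 2 * dirDeriv e (dirDeriv e v) p := by
  have h1 : dirDeriv (r • e) v = fun q => (r : ℂ) * dirDeriv e v q := by
    funext q
    simp [dirDeriv]
  have hd : DifferentiableAt ℝ (dirDeriv e v) p :=
    (hv.dirDeriv (m := 1) (by norm_num) e).differentiable (by norm_num) p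
  rw [h1]
  change fderiv ℝ (fun q => (r : ℂ) * dirDeriv e v q) p (r • e) = _
  rw [fderiv_const_mul hd]
  simp [dirDeriv]
  ring

lemma hasDerivAt_comp_line {v : E → ℂ} (hv : Differentiable ℝ v) (p e : E) (s : ℝ) :
    HasDerivAt (fun t : ℝ => v (p + t • e)) (dirDeriv e v (p + s • e)) s := by
  have h : HasDerivAt (fun t : ℝ => p + t • e) e s := by
    simpa using ((hasDerivAt_id s).smul_const e).const_add p
  exact (hv (p + s • e)).hasFDerivAt.comp_hasDerivAt s h

lemma hasDerivAt_comp_neg_line {v : E → ℂ} (hv : Differentiable ℝ v) (p e : E) (s : ℝ) :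
    HasDerivAt (fun t : ℝ => v (p - t • e)) (-dirDeriv e v (p - s • e)) s := by
  have h : HasDerivAt (fun t : ℝ => p - t • e) (-e) s := by
    simpa using ((hasDerivAt_id s).smul_const e).const_sub p
  exact ((hv (p - s • e)).hasFDerivAt.comp_hasDerivAt s h).congr_deriv (by simp [dirDeriv])

lemma norm_le_of_norm_second_deriv_le {ψ ψ' ψ'' : ℝ → ℂ} {h K : ℝ}
    (h1 : ∀ s, HasDerivAt ψ (ψ' s) s) (h2 : ∀ s, HasDerivAt ψ' (ψ'' s) s)
    (z0 : ψ 0 = 0) (z1 : ψ' 0 = 0) (hh : 0 ≤ h) (hK : 0 ≤ K)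
    (hb : ∀ s, 0 ≤ s → s ≤ h → ‖ψ'' s‖ ≤ K) : ‖ψ h‖ ≤ K * h ^ 2 := by
  have e1 : ∀ s, 0 ≤ s → s ≤ h → ‖ψ' s‖ ≤ K * h := by
    intro s hs hsh
    have := norm_image_sub_le_of_norm_deriv_le_segment' (f := ψ') (f' := ψ'') (C := K)
      (a := 0) (b := h) (fun x _ => (h2 x).hasDerivWithinAt)
      (fun x hx => hb x hx.1 hx.2.le) s ⟨hs, hsh⟩
    rw [z1, sub_zero, sub_zero] at this
    exact this.trans (by gcongr)
  have := norm_image_sub_le_of_norm_deriv_le_segment' (f := ψ) (f' := ψ') (C := K * h)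
      (a := 0) (b := h) (fun x _ => (h1 x).hasDerivWithinAt)
      (fun x hx => e1 x hx.1 hx.2.le) h ⟨hh, le_rfl⟩
  rw [z0, sub_zero, sub_zero] at this
  exact this.trans (by rw [pow_two, mul_assoc])

lemma hasDerivAt_centralDiff {v : E → ℂ} (hv : Differentiable ℝ v) (p e : E) (s : ℝ) :
    HasDerivAt (fun t : ℝ => centralDiff (t • e) v p)
      (dirDeriv e v (p + s • e) - dirDeriv e v (p - s • e)) s := by
  have h := ((hasDerivAt_comp_neg_line hv p e s).sub_const (2 * v p)).add
    (hasDerivAt_comp_line hv p e s)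
  exact h.congr_deriv (by ring)

lemma hasDerivAt_dirDeriv_sub {v : E → ℂ} (hv : ContDiff ℝ 2 v) (p e : E) (s : ℝ) :
    HasDerivAt (fun t : ℝ => dirDeriv e v (p + t • e) - dirDeriv e v (p - t • e))
      (dirDeriv e (dirDeriv e v) (p + s • e) + dirDeriv e (dirDeriv e v) (p - s • e)) s := by
  have hd : Differentiable ℝ (dirDeriv e v) :=
    (hv.dirDeriv (m := 1) (by norm_num) e).differentiable (by norm_num)
  have h := (hasDerivAt_comp_line hd p e s).sub (hasDerivAt_comp_neg_line hd p e s)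
  exact h.congr_deriv (by ring)

lemma norm_centralDiff_le {v : E → ℂ} (hv : ContDiff ℝ 2 v) {p e : E} {h M : ℝ}
    (hh : 0 ≤ h) (hM : 0 ≤ M)
    (hb : ∀ s : ℝ, |s| ≤ h → ‖dirDeriv e (dirDeriv e v) (p + s • e)‖ ≤ M) :
    ‖centralDiff (h • e) v p‖ ≤ 2 * M * h ^ 2 := by
  refine norm_le_of_norm_second_deriv_le (ψ := fun t : ℝ => centralDiff (t • e) v p)
    (fun s => hasDerivAt_centralDiff (hv.differentiable (by norm_num)) p e s)
    (fun s => hasDerivAt_dirDeriv_sub hv p e s) ?_ ?_ hh (by positivity) ?_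
  · simp [centralDiff]; ring
  · simp
  · intro s hs hsh
    have a1 := hb s (by rwa [abs_of_nonneg hs])
    have a2 := hb (-s) (by rwa [abs_neg, abs_of_nonneg hs])
    rw [neg_smul, ← sub_eq_add_neg] at a2
    exact (norm_add_le _ _).trans (by linarith)

lemma norm_centralDiff_sub_le {v : E → ℂ} (hv : ContDiff ℝ 4 v) {p e : E} {h M : ℝ}
    (hh : 0 ≤ h) (hM : 0 ≤ M)
    (hb : ∀ s : ℝ, |s| ≤ h →
      ‖dirDeriv e (dirDeriv e (dirDeriv e (dirDeriv e v))) (p + s • e)‖ ≤ M) :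
    ‖centralDiff (h • e) v p - (h : ℂ) ^ 2 * dirDeriv e (dirDeriv e v) p‖ ≤ 2 * M * h ^ 4 := by
  have hv2 : ContDiff ℝ 2 v := hv.of_le (by norm_num)
  have hD : ContDiff ℝ 2 (dirDeriv e (dirDeriv e v)) := hv.dirDeriv_dirDeriv (by norm_num) e
  set c := dirDeriv e (dirDeriv e v) p with hc
  have key : ‖centralDiff (h • e) v p - (h : ℂ) ^ 2 * c‖ ≤ 2 * M * h ^ 2 * h ^ 2 := by
    refine norm_le_of_norm_second_deriv_le
      (ψ := fun t : ℝ => centralDiff (t • e) v p - (t : ℂ) ^ 2 * c)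
      (ψ' := fun t : ℝ => (dirDeriv e v (p + t • e) - dirDeriv e v (p - t • e)) - 2 * (t : ℂ) * c)
      (ψ'' := fun t : ℝ => centralDiff (t • e) (dirDeriv e (dirDeriv e v)) p)
      (fun s => ?_) (fun s => ?_) ?_ ?_ hh (by positivity) ?_
    · have hs : HasDerivAt (fun t : ℝ => (t : ℂ)) 1 s := Complex.ofRealCLM.hasDerivAt
      exact ((hasDerivAt_centralDiff (hv.differentiable (by norm_num)) p e s).sub
        ((hs.pow 2).mul_const c)).congr_deriv (by simp)
    · have hs : HasDerivAt (fun t : ℝ => (t : ℂ)) 1 s := Complex.ofRealCLM.hasDerivAt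
      exact ((hasDerivAt_dirDeriv_sub hv2 p e s).sub
        ((hs.const_mul 2).mul_const c)).congr_deriv (by rw [centralDiff, ← hc]; ring)
    · simp [centralDiff]; ring
    · simp
    · intro s hs hsh
      exact (norm_centralDiff_le hD hs hM fun t ht => hb t (ht.trans hsh)).trans (by gcongr)
  exact key.trans (by rw [mul_assoc, ← pow_add])

lemma norm_centralDiff_sub_sub_le {v : E → ℂ} (hv : ContDiff ℝ 6 v) {p e : E} {h M : ℝ}
    (hh : 0 ≤ h) (hM : 0 ≤ M)
    (hb : ∀ s : ℝ, |s| ≤ h → ‖dirDeriv e (dirDeriv e (dirDeriv e (dirDeriv e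
      (dirDeriv e (dirDeriv e v))))) (p + s • e)‖ ≤ M) :
    ‖centralDiff (h • e) v p - (h : ℂ) ^ 2 * dirDeriv e (dirDeriv e v) p
      - (h : ℂ) ^ 4 / 12 * dirDeriv e (dirDeriv e (dirDeriv e (dirDeriv e v))) p‖
        ≤ 2 * M * h ^ 6 := by
  have hv2 : ContDiff ℝ 2 v := hv.of_le (by norm_num)
  have hD : ContDiff ℝ 4 (dirDeriv e (dirDeriv e v)) := hv.dirDeriv_dirDeriv (by norm_num) e
  set d := dirDeriv e (dirDeriv e (dirDeriv e (dirDeriv e v))) p with hd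
  set c := dirDeriv e (dirDeriv e v) p with hc
  have key : ‖centralDiff (h • e) v p - (h : ℂ) ^ 2 * c - (h : ℂ) ^ 4 / 12 * d‖
      ≤ 2 * M * h ^ 4 * h ^ 2 := by
    refine norm_le_of_norm_second_deriv_le
      (ψ := fun t : ℝ => centralDiff (t • e) v p - (t : ℂ) ^ 2 * c - (t : ℂ) ^ 4 / 12 * d)
      (ψ' := fun t : ℝ => (dirDeriv e v (p + t • e) - dirDeriv e v (p - t • e))
        - 2 * (t : ℂ) * c - (t : ℂ) ^ 3 / 3 * d)
      (ψ'' := fun t : ℝ => centralDiff (t • e) (dirDeriv e (dirDeriv e v)) p - (t : ℂ) ^ 2 * d)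
      (fun s => ?_) (fun s => ?_) ?_ ?_ hh (by positivity) ?_
    · have hs : HasDerivAt (fun t : ℝ => (t : ℂ)) 1 s := Complex.ofRealCLM.hasDerivAt
      exact (((hasDerivAt_centralDiff (hv.differentiable (by norm_num)) p e s).sub
        ((hs.pow 2).mul_const c)).sub (((hs.pow 4).div_const 12).mul_const d)).congr_deriv
          (by push_cast; ring)
    · have hs : HasDerivAt (fun t : ℝ => (t : ℂ)) 1 s := Complex.ofRealCLM.hasDerivAt
      exact (((hasDerivAt_dirDeriv_sub hv2 p e s).sub
        ((hs.const_mul 2).mul_const c)).sub (((hs.pow 3).div_const 3).mul_const d)).congr_deriv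
          (by rw [centralDiff, ← hc]; simp; ring)
    · simp [centralDiff]; ring
    · simp
    · intro s hs hsh
      exact (norm_centralDiff_sub_le hD hs hM fun t ht => hb t (ht.trans hsh)).trans (by gcongr)
  exact key.trans (by rw [mul_assoc, ← pow_add])

lemma exists_norm_le_on_parallelogram {g : E → ℂ} (hg : Continuous g) (p a b : E) :
    ∃ M, 0 ≤ M ∧ ∀ s t : ℝ, |s| ≤ 1 → |t| ≤ 1 → ‖g (p + s • a + t • b)‖ ≤ M := by
  have hK : IsCompact (Set.Icc (-1 : ℝ) 1 ×ˢ Set.Icc (-1 : ℝ) 1) := isCompact_Icc.prod isCompact_Icc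
  obtain ⟨M, hM⟩ := hK.exists_bound_of_continuousOn
    (f := fun q : ℝ × ℝ => g (p + q.1 • a + q.2 • b)) (by fun_prop)
  refine ⟨max M 0, le_max_right _ _, fun s t hs ht => le_max_of_le_left ?_⟩
  exact hM (s, t) ⟨abs_le.1 hs, abs_le.1 ht⟩

/-- One-dimensional fourth-order Padé compact approximation. -/
lemma exists_norm_compact_pure_le {v : E → ℂ} (hv : ContDiff ℝ 6 v) (p e : E) :
    ∃ C, 0 ≤ C ∧ ∀ h : ℝ, 0 ≤ h → h ≤ 1 →
      ‖centralDiff (h • e) v p - (h : ℂ) ^ 2 * dirDeriv e (dirDeriv e v) p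
        - (h : ℂ) ^ 2 / 12 * centralDiff (h • e) (dirDeriv e (dirDeriv e v)) p‖ ≤ C * h ^ 6 := by
  have hD : ContDiff ℝ 4 (dirDeriv e (dirDeriv e v)) := hv.dirDeriv_dirDeriv (by norm_num) e
  have hD4 : ContDiff ℝ 2 (dirDeriv e (dirDeriv e (dirDeriv e (dirDeriv e v)))) :=
    hD.dirDeriv_dirDeriv (by norm_num) e
  have hD6 : ContDiff ℝ 0 (dirDeriv e (dirDeriv e (dirDeriv e (dirDeriv e
    (dirDeriv e (dirDeriv e v)))))) := hD4.dirDeriv_dirDeriv (by norm_num) e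
  obtain ⟨M, hM, hb⟩ := exists_norm_le_on_parallelogram hD6.continuous p e 0
  refine ⟨2 * M + 1 / 12 * (2 * M), by positivity, fun h hh h1 => ?_⟩
  have hb' : ∀ s : ℝ, |s| ≤ h → ‖dirDeriv e (dirDeriv e (dirDeriv e (dirDeriv e
      (dirDeriv e (dirDeriv e v))))) (p + s • e)‖ ≤ M := fun s hs => by
    simpa using hb s 0 (hs.trans h1) (by simp)
  have a1 := norm_centralDiff_sub_sub_le hv hh hM hb'
  have a2 := norm_centralDiff_sub_le hD hh hM hb'
  have hn : ‖(h : ℂ) ^ 2 / 12‖ = h ^ 2 / 12 := by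
    simp
  have a3 := mul_le_mul_of_nonneg_left a2 (norm_nonneg ((h : ℂ) ^ 2 / 12))
  rw [← norm_mul, hn] at a3
  refine le_of_eq_of_le (congrArg _ ?_) ((norm_sub_le_of_le a1 a3).trans_eq ?_) <;> ring

lemma exists_norm_compact_mixed_le {v : E → ℂ} (hv : ContDiff ℝ 6 v) (p a b : E) :
    ∃ C, 0 ≤ C ∧ ∀ h : ℝ, 0 ≤ h → h ≤ 1 →
      ‖centralDiff (h • a) (centralDiff (h • b) v) p
        - (h : ℂ) ^ 2 * centralDiff (h • a) (dirDeriv b (dirDeriv b v)) p‖ ≤ C * h ^ 6 := by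
  have hA : ContDiff ℝ 4 (dirDeriv a (dirDeriv a v)) := hv.dirDeriv_dirDeriv (by norm_num) a
  have hB : ContDiff ℝ 4 (dirDeriv b (dirDeriv b v)) := hv.dirDeriv_dirDeriv (by norm_num) b
  have hA4 : ContDiff ℝ 2 (dirDeriv b (dirDeriv b (dirDeriv a (dirDeriv a v)))) :=
    hA.dirDeriv_dirDeriv (by norm_num) b
  have hA6 : ContDiff ℝ 0 (dirDeriv b (dirDeriv b (dirDeriv b (dirDeriv b
    (dirDeriv a (dirDeriv a v)))))) := hA4.dirDeriv_dirDeriv (by norm_num) b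
  obtain ⟨M, hM, hb⟩ := exists_norm_le_on_parallelogram hA6.continuous p a b
  refine ⟨2 * (2 * M), by positivity, fun h hh h1 => ?_⟩
  let R : E → ℂ := fun q => centralDiff (h • b) v q - (h : ℂ) ^ 2 * dirDeriv b (dirDeriv b v) q
  have hR : ∀ {n : WithTop ℕ∞} {g g' : E → ℂ}, ContDiff ℝ n g → ContDiff ℝ n g' →
      ContDiff ℝ n (fun q => centralDiff (h • b) g q - (h : ℂ) ^ 2 * g' q) := by
    intro n g g' hg hg'
    unfold centralDiff
    fun_prop
  have hdir : ∀ {g g' : E → ℂ}, Differentiable ℝ g → Differentiable ℝ g' →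
      dirDeriv a (fun q => centralDiff (h • b) g q - (h : ℂ) ^ 2 * g' q) =
        fun q => centralDiff (h • b) (dirDeriv a g) q - (h : ℂ) ^ 2 * dirDeriv a g' q := by
    intro g g' hg hg'
    funext q
    have hl : ∀ {g : E → ℂ}, Differentiable ℝ g → ∀ q,
        HasDerivAt (fun t : ℝ => g (q + t • a)) (dirDeriv a g q) 0 := fun hg q => by
      simpa using hasDerivAt_comp_line hg q a 0
    have hG : Differentiable ℝ (fun q => centralDiff (h • b) g q - (h : ℂ) ^ 2 * g' q) := by
      unfold centralDiff
      fun_prop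
    refine (hl hG q).unique ?_
    have := ((((hl hg (q - h • b)).sub ((hl hg q).const_mul 2)).add (hl hg (q + h • b))).sub
      ((hl hg' q).const_mul ((h : ℂ) ^ 2)))
    refine this.congr_of_eventuallyEq (Filter.Eventually.of_forall fun t => ?_)
    simp only [centralDiff, Pi.sub_apply, Pi.add_apply]
    rw [add_sub_right_comm q, add_right_comm q]
  have hRR : dirDeriv a (dirDeriv a R) = fun q => centralDiff (h • b) (dirDeriv a (dirDeriv a v)) q
      - (h : ℂ) ^ 2 * dirDeriv b (dirDeriv b (dirDeriv a (dirDeriv a v))) q := by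
    rw [hdir (hv.differentiable (by norm_num)) (hB.differentiable (by norm_num)),
      hdir ((hv.dirDeriv (m := 5) (by norm_num) a).differentiable (by norm_num))
        ((hB.dirDeriv (m := 3) (by norm_num) a).differentiable (by norm_num)),
      dirDeriv_sq_comm (hv.of_le (by norm_num)) a b]
  have key := norm_centralDiff_le (v := R) (p := p) (e := a) (h := h) (M := 2 * M * h ^ 4)
    (hR (hv.of_le (by norm_num)) (hB.of_le (by norm_num))) hh (by positivity) (by
      intro s hs
      rw [hRR]
      exact norm_centralDiff_sub_le hA hh hM fun t ht => hb s t (hs.trans h1) (ht.trans h1))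
  calc _ = ‖centralDiff (h • a) R p‖ := by
        congr 1
        simp only [R, centralDiff]
        ring
    _ ≤ _ := key
    _ = _ := by ring

end CentralDifference

lemma centralDiff_comm {E : Type*} [NormedAddCommGroup E] (a b : E) (v : E → ℂ) (p : E) :
    centralDiff a (centralDiff b v) p = centralDiff b (centralDiff a v) p := by
  simp only [centralDiff]
  rw [sub_right_comm p a b, add_sub_right_comm p a b, add_right_comm p a b,
    ← add_sub_right_comm p b a]
  ring

lemma deriv_deriv_eq_dirDeriv {E : Type*} [NormedAddCommGroup E] [NormedSpace ℝ E] {v : E → ℂ}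
    (hv : ContDiff ℝ 2 v) {γ : ℝ → E} {e : E} (hγ : ∀ t, HasDerivAt γ e t) (t : ℝ) :
    deriv (deriv (fun s => v (γ s))) t = dirDeriv e (dirDeriv e v) (γ t) := by
  have key : ∀ {g : E → ℂ}, Differentiable ℝ g →
      deriv (fun s => g (γ s)) = fun s => dirDeriv e g (γ s) := fun hg => by
    funext s
    exact ((hg (γ s)).hasFDerivAt.comp_hasDerivAt s (hγ s)).deriv
  rw [key (hv.differentiable (by norm_num)),
    key ((hv.dirDeriv (m := 1) (by norm_num) e).differentiable (by norm_num))]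

/-- Fourth-order truncation error of the Padé compact scheme for the 3D
Helmholtz equation `∇²u + k(z)²u = f`: with steps `h_x = r_x h`, `h_y = r_y h`,
`h_z = r_z h`, `w = k(z)²u`, the compact-scheme residual
`(δ_x²+δ_y²+δ_z²)u + ((h_x²+h_y²)/12)δ_x²δ_y²u + ((h_x²+h_z²)/12)δ_x²δ_z²u
 + ((h_y²+h_z²)/12)δ_y²δ_z²u + (1 + (h_x²/12)δ_x² + (h_y²/12)δ_y² + (h_z²/12)δ_z²)w
 − (1 + (h_x²/12)δ_x² + (h_y²/12)δ_y² + (h_z²/12)δ_z²)f`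
at a fixed point is `O(h⁴)` as `h → 0⁺`. -/
theorem fourth_order_compact_scheme_truncation
    (u : ℝ → ℝ → ℝ → ℂ)
    (hu : ContDiff ℝ 6 (fun p : ℝ × ℝ × ℝ => u p.1 p.2.1 p.2.2))
    (k : ℝ → ℂ) (hk : ContDiff ℝ 4 k)
    (f w : ℝ → ℝ → ℝ → ℂ)
    (hf : ∀ x y z, f x y z =
      deriv (deriv (fun t => u t y z)) x
        + deriv (deriv (fun t => u x t z)) y
        + deriv (deriv (fun t => u x y t)) z
        + (k z) ^ 2 * u x y z)
    (hw : ∀ x y z, w x y z = (k z) ^ 2 * u x y z)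
    (x y z : ℝ) (rx ry rz : ℝ) (hrx : 0 < rx) (hry : 0 < ry) (hrz : 0 < rz) :
    ∃ C > (0 : ℝ), ∃ h₀ > (0 : ℝ), ∀ h : ℝ, 0 < h → h < h₀ →
      ‖(deltaX2 (rx * h) u x y z + deltaY2 (ry * h) u x y z + deltaZ2 (rz * h) u x y z)
          + ((((rx * h) ^ 2 + (ry * h) ^ 2 : ℝ)) : ℂ) / 12
              * deltaX2 (rx * h) (deltaY2 (ry * h) u) x y z
          + ((((rx * h) ^ 2 + (rz * h) ^ 2 : ℝ)) : ℂ) / 12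
              * deltaX2 (rx * h) (deltaZ2 (rz * h) u) x y z
          + ((((ry * h) ^ 2 + (rz * h) ^ 2 : ℝ)) : ℂ) / 12
              * deltaY2 (ry * h) (deltaZ2 (rz * h) u) x y z
          + (w x y z
              + ((((rx * h) ^ 2 : ℝ)) : ℂ) / 12 * deltaX2 (rx * h) w x y z
              + ((((ry * h) ^ 2 : ℝ)) : ℂ) / 12 * deltaY2 (ry * h) w x y z
              + ((((rz * h) ^ 2 : ℝ)) : ℂ) / 12 * deltaZ2 (rz * h) w x y z)
          - (f x y z
              + ((((rx * h) ^ 2 : ℝ)) : ℂ) / 12 * deltaX2 (rx * h) f x y z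
              + ((((ry * h) ^ 2 : ℝ)) : ℂ) / 12 * deltaY2 (ry * h) f x y z
              + ((((rz * h) ^ 2 : ℝ)) : ℂ) / 12 * deltaZ2 (rz * h) f x y z)‖
        ≤ C * h ^ 4 := by
  set U : ℝ × ℝ × ℝ → ℂ := fun p => u p.1 p.2.1 p.2.2 with hU
  set W : ℝ × ℝ × ℝ → ℂ := fun p => w p.1 p.2.1 p.2.2 with hW
  set p : ℝ × ℝ × ℝ := (x, y, z) with hp
  set e₁ : ℝ × ℝ × ℝ := rx • ((1 : ℝ), (0 : ℝ), (0 : ℝ)) with he₁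
  set e₂ : ℝ × ℝ × ℝ := ry • ((0 : ℝ), (1 : ℝ), (0 : ℝ)) with he₂
  set e₃ : ℝ × ℝ × ℝ := rz • ((0 : ℝ), (0 : ℝ), (1 : ℝ)) with he₃
  set D₁ := dirDeriv e₁ (dirDeriv e₁ U) with hD₁
  set D₂ := dirDeriv e₂ (dirDeriv e₂ U) with hD₂
  set D₃ := dirDeriv e₃ (dirDeriv e₃ U) with hD₃
  have hU2 : ContDiff ℝ 2 U := hu.of_le (by norm_num)
  have cx : (rx : ℂ) ≠ 0 := by exact_mod_cast hrx.ne'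
  have cy : (ry : ℂ) ≠ 0 := by exact_mod_cast hry.ne'
  have cz : (rz : ℂ) ≠ 0 := by exact_mod_cast hrz.ne'
  have hF : ∀ x y z, f x y z = D₁ (x, y, z) / (rx : ℂ) ^ 2 + D₂ (x, y, z) / (ry : ℂ) ^ 2
      + D₃ (x, y, z) / (rz : ℂ) ^ 2 + W (x, y, z) := by
    intro x y z
    have d1 := deriv_deriv_eq_dirDeriv hU2 (γ := fun t => (t, y, z))
      (fun t => (hasDerivAt_id t).prodMk ((hasDerivAt_const t y).prodMk (hasDerivAt_const t z))) x
    have d2 := deriv_deriv_eq_dirDeriv hU2 (γ := fun t => (x, t, z))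
      (fun t => (hasDerivAt_const t x).prodMk ((hasDerivAt_id t).prodMk (hasDerivAt_const t z))) y
    have d3 := deriv_deriv_eq_dirDeriv hU2 (γ := fun t => (x, y, t))
      (fun t => (hasDerivAt_const t x).prodMk ((hasDerivAt_const t y).prodMk (hasDerivAt_id t))) z
    simp only [hU] at d1 d2 d3
    rw [hf, d1, d2, d3, hD₁, hD₂, hD₃, he₁, he₂, he₃, dirDeriv_smul_sq hU2, dirDeriv_smul_sq hU2,
      dirDeriv_smul_sq hU2, hW]
    simp only [hw]
    field_simp
    rfl
  obtain ⟨C₁, p₁, b₁⟩ := exists_norm_compact_pure_le hu p e₁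
  obtain ⟨C₂, p₂, b₂⟩ := exists_norm_compact_pure_le hu p e₂
  obtain ⟨C₃, p₃, b₃⟩ := exists_norm_compact_pure_le hu p e₃
  obtain ⟨C₁₂, p₁₂, b₁₂⟩ := exists_norm_compact_mixed_le hu p e₁ e₂
  obtain ⟨C₂₁, p₂₁, b₂₁⟩ := exists_norm_compact_mixed_le hu p e₂ e₁
  obtain ⟨C₁₃, p₁₃, b₁₃⟩ := exists_norm_compact_mixed_le hu p e₁ e₃
  obtain ⟨C₃₁, p₃₁, b₃₁⟩ := exists_norm_compact_mixed_le hu p e₃ e₁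
  obtain ⟨C₂₃, p₂₃, b₂₃⟩ := exists_norm_compact_mixed_le hu p e₂ e₃
  obtain ⟨C₃₂, p₃₂, b₃₂⟩ := exists_norm_compact_mixed_le hu p e₃ e₂
  refine ⟨(C₁ + C₂₁ + C₃₁) / rx ^ 2 + (C₂ + C₁₂ + C₃₂) / ry ^ 2 + (C₃ + C₁₃ + C₂₃) / rz ^ 2 + 1,
    by positivity, 1, one_pos, fun h h0 h1 => ?_⟩
  have ch : (h : ℂ) ≠ 0 := by exact_mod_cast h0.ne'
  have X : ∀ g : ℝ → ℝ → ℝ → ℂ, ∀ x y z, deltaX2 (rx * h) g x y z =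
      centralDiff (h • e₁) (fun q => g q.1 q.2.1 q.2.2) (x, y, z) / ((rx : ℂ) * h) ^ 2 := by
    intro g x y z
    simp [deltaX2, centralDiff, he₁, mul_comm]
  have Y : ∀ g : ℝ → ℝ → ℝ → ℂ, ∀ x y z, deltaY2 (ry * h) g x y z =
      centralDiff (h • e₂) (fun q => g q.1 q.2.1 q.2.2) (x, y, z) / ((ry : ℂ) * h) ^ 2 := by
    intro g x y z
    simp [deltaY2, centralDiff, he₂, mul_comm]
  have Z : ∀ g : ℝ → ℝ → ℝ → ℂ, ∀ x y z, deltaZ2 (rz * h) g x y z =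
      centralDiff (h • e₃) (fun q => g q.1 q.2.1 q.2.2) (x, y, z) / ((rz : ℂ) * h) ^ 2 := by
    intro g x y z
    simp [deltaZ2, centralDiff, he₃, mul_comm]
  have hlin : ∀ e : ℝ × ℝ × ℝ, centralDiff e (fun q => f q.1 q.2.1 q.2.2) p =
      centralDiff e D₁ p / (rx : ℂ) ^ 2 + centralDiff e D₂ p / (ry : ℂ) ^ 2
        + centralDiff e D₃ p / (rz : ℂ) ^ 2 + centralDiff e W p := by
    intro e
    simp only [centralDiff, hF]
    ring
  have hdiv : ∀ (e : ℝ × ℝ × ℝ) (G : ℝ × ℝ × ℝ → ℂ) (c : ℂ),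
      centralDiff e (fun q => G q / c) p = centralDiff e G p / c := by
    intro e G c
    simp only [centralDiff]
    ring
  have XY : deltaX2 (rx * h) (deltaY2 (ry * h) u) x y z =
      centralDiff (h • e₁) (centralDiff (h • e₂) U) p / ((ry : ℂ) * h) ^ 2
        / ((rx : ℂ) * h) ^ 2 := by
    rw [X, ← hdiv (h • e₁) _ (((ry : ℂ) * h) ^ 2)]
    simp only [Y]
    rfl
  have XZ : deltaX2 (rx * h) (deltaZ2 (rz * h) u) x y z =
      centralDiff (h • e₁) (centralDiff (h • e₃) U) p / ((rz : ℂ) * h) ^ 2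
        / ((rx : ℂ) * h) ^ 2 := by
    rw [X, ← hdiv (h • e₁) _ (((rz : ℂ) * h) ^ 2)]
    simp only [Z]
    rfl
  have YZ : deltaY2 (ry * h) (deltaZ2 (rz * h) u) x y z =
      centralDiff (h • e₂) (centralDiff (h • e₃) U) p / ((rz : ℂ) * h) ^ 2
        / ((ry : ℂ) * h) ^ 2 := by
    rw [Y, ← hdiv (h • e₂) _ (((rz : ℂ) * h) ^ 2)]
    simp only [Z]
    rfl
  have hb : ∀ {A : ℂ} {C : ℝ} (r : ℝ), 0 < r → ‖A‖ ≤ C * h ^ 6 →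
      ‖A / ((r : ℂ) ^ 2 * (h : ℂ) ^ 2)‖ ≤ C / r ^ 2 * h ^ 4 := by
    intro A C r hr hA
    have hn : ‖(r : ℂ) ^ 2 * (h : ℂ) ^ 2‖ = r ^ 2 * h ^ 2 := by simp
    rw [norm_div, hn, div_le_iff₀ (by positivity)]
    refine hA.trans_eq ?_
    field_simp
  have hb' : ∀ {A : ℂ} {C : ℝ} (r : ℝ), 0 < r → 0 ≤ C → ‖A‖ ≤ C * h ^ 6 →
      ‖A / (12 * ((r : ℂ) ^ 2 * (h : ℂ) ^ 2))‖ ≤ C / r ^ 2 * h ^ 4 := by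
    intro A C r hr hC hA
    rw [mul_comm (12 : ℂ), ← div_div, norm_div]
    refine (div_le_self (norm_nonneg _) (by norm_num)).trans (hb r hr hA)
  have t₁ := hb rx hrx (b₁ h h0.le h1.le)
  have t₂ := hb ry hry (b₂ h h0.le h1.le)
  have t₃ := hb rz hrz (b₃ h h0.le h1.le)
  have t₁₂ := hb' ry hry p₁₂ (b₁₂ h h0.le h1.le)
  have t₂₁ := hb' rx hrx p₂₁ (b₂₁ h h0.le h1.le)
  have t₁₃ := hb' rz hrz p₁₃ (b₁₃ h h0.le h1.le)
  have t₃₁ := hb' rx hrx p₃₁ (b₃₁ h h0.le h1.le)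
  have t₂₃ := hb' rz hrz p₂₃ (b₂₃ h h0.le h1.le)
  have t₃₂ := hb' ry hry p₃₂ (b₃₂ h h0.le h1.le)
  rw [centralDiff_comm] at t₂₁ t₃₁ t₃₂
  have hsum := norm_add_le_of_le (norm_add_le_of_le (norm_add_le_of_le (norm_add_le_of_le
    (norm_add_le_of_le (norm_add_le_of_le (norm_add_le_of_le (norm_add_le_of_le t₁ t₂) t₃)
      t₁₂) t₂₁) t₁₃) t₃₁) t₂₃) t₃₂
  refine le_trans (le_of_eq_of_le (congrArg _ ?_) hsum) ?_
  · rw [XY, XZ, YZ, X u, Y u, Z u, X w, Y w, Z w, X f, Y f, Z f, hlin, hlin, hlin, hF]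
    simp only [← hU, ← hW, ← hp, ← hD₁, ← hD₂, ← hD₃]
    have hWp : w x y z = W p := rfl
    rw [hWp]
    push_cast
    generalize centralDiff (h • e₁) (centralDiff (h • e₂) U) p = a₁₂
    generalize centralDiff (h • e₁) (centralDiff (h • e₃) U) p = a₁₃
    generalize centralDiff (h • e₂) (centralDiff (h • e₃) U) p = a₂₃
    field_simp
    ring
  · have : 0 < h ^ 4 := by positivity
    refine le_of_eq_of_le ?_ (mul_le_mul_of_nonneg_right (le_add_of_nonneg_right zero_le_one)
      this.le)
    ring
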